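/- arXiv:1606.07144 — 4 statements merged into one kernel-verified Lean document; each statement's English description precedes it below -/
import Mathlib

section
/- For every natural number N ≥ 2, the images of the fifteen vectors g^0, …, g^14 in (ZMod N)^{24} are linearly independent over ZMod N; in particular, the submodule they generate has exactly N^{15} elements. -/
/-- The index sets of the fifteen generators `g^0, …, g^14`. -/
def gSet : Fin 15 → Finset ℕ :=
  ![{7, 18}, {0, 23}, {5, 8}, {12, 19}, {6, 13}, {1, 14}, {15, 22}, {9, 16}, {4, 17},
    {3, 20}, {2, 11}, {0, 3, 7, 10, 12, 15}, {1, 4, 6, 9, 19, 22}, {2, 5, 13, 16, 18, 21},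
    {8, 11, 14, 17, 20, 23}]

/-- The generators `g^0, …, g^14 ∈ {0,1}^24 ⊆ ℤ^24`. -/
def gVec (i : Fin 15) (n : Fin 24) : ℤ := if (n : ℕ) ∈ gSet i then 1 else 0

/-- The vectors `g^0, …, g^14` are linearly independent over every commutative ring. -/
theorem linearIndependent_intCast_gVec (R : Type*) [CommRing R] :
    LinearIndependent R (fun i : Fin 15 => fun n : Fin 24 => ((gVec i n : ℤ) : R)) := by
  rw [Fintype.linearIndependent_iff]
  intro c hc
  have coord (n : Fin 24) : ∑ i, c i * ((gVec i n : ℤ) : R) = 0 := by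
    simpa using congrFun hc n
  have e0 := coord 0
  have e1 := coord 1
  have e2 := coord 2
  have e3 := coord 3
  have e4 := coord 4
  have e5 := coord 5
  have e6 := coord 6
  have e7 := coord 7
  have e9 := coord 9
  have e10 := coord 10
  have e12 := coord 12
  have e15 := coord 15
  have e19 := coord 19
  have e21 := coord 21
  have e23 := coord 23
  simp [Fin.sum_univ_succ, gVec, gSet] at e0 e1 e2 e3 e4 e5 e6 e7 e9 e10 e12 e15 e19 e21 e23
  intro i
  fin_cases i <;> simp <;> grind

/-- The span of a finite linearly independent family has as many elements as the free module
on its index type. -/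
theorem LinearIndependent.natCard_span {R M ι : Type*} [Ring R] [AddCommGroup M] [Module R M]
    [Fintype ι] {v : ι → M} (hv : LinearIndependent R v) :
    Nat.card (Submodule.span R (Set.range v)) = Nat.card R ^ Fintype.card ι := by
  rw [← Nat.card_congr hv.linearCombinationEquiv.toEquiv,
    Nat.card_congr Finsupp.equivFunOnFinite, Nat.card_fun, Nat.card_eq_fintype_card (α := ι)]

/-- For every `N ≥ 2`, the images of `g^0, …, g^14` in `(ZMod N)^24` are linearly
independent over `ZMod N`; in particular the submodule they span has exactly `N^15`
elements. -/
theorem gVec_linearIndependent_card_span (N : ℕ) (hN : 2 ≤ N) :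
    LinearIndependent (ZMod N)
      (fun i : Fin 15 => fun n : Fin 24 => ((gVec i n : ℤ) : ZMod N)) ∧
    Nat.card (Submodule.span (ZMod N)
      (Set.range (fun i : Fin 15 => fun n : Fin 24 => ((gVec i n : ℤ) : ZMod N)))) =
      N ^ 15 := by
  have hli := linearIndependent_intCast_gVec (ZMod N)
  refine ⟨hli, ?_⟩
  rw [hli.natCard_span, Nat.card_zmod, Fintype.card_fin]
end

section
/- For every vector x in the ZMod 2-linear span of the images of g^0, …, g^14 in (ZMod 2)^{24}, one has ∑_{n=0}^{23} x_n · x_{π(n)} = 0 in ZMod 2. (Consequently every flat configuration contributes to the N = 2 Kashaev torus partition sum with sign +1.) -/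
open Finset

/-- The permutation `π = (0 13 20 9)(1 18 17 10)(2 19 8 15)(3 6 23 16)(4 7 14 21)(5 12 11 22)`
of `{0, …, 23}`. -/
def piPerm : Fin 24 → Fin 24 :=
  ![13, 18, 19, 6, 7, 12, 23, 14, 15, 0, 1, 22, 11, 20, 21, 2, 3, 10, 17, 8, 9, 4, 5, 16]

/-- If a quadratic form `x ↦ ∑ n, x n * x (σ n)` and its polarization vanish on a family of
vectors, then the form vanishes on the span of the family. -/
theorem sum_mul_comp_eq_zero_of_mem_span {R ι κ : Type*} [CommRing R] [Fintype ι]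
    (σ : ι → ι) (v : κ → ι → R) (hq : ∀ i, ∑ n, v i n * v i (σ n) = 0)
    (hp : ∀ i j, ∑ n, (v i n * v j (σ n) + v j n * v i (σ n)) = 0)
    {x : ι → R} (hx : x ∈ Submodule.span R (Set.range v)) : ∑ n, x n * x (σ n) = 0 := by
  have polar : ∀ y ∈ Submodule.span R (Set.range v), ∀ z ∈ Submodule.span R (Set.range v),
      ∑ n, (y n * z (σ n) + z n * y (σ n)) = 0 := by
    intro y hy z hz
    induction hy, hz using Submodule.span_induction₂ with
    | mem_mem y z hy hz =>
      obtain ⟨i, rfl⟩ := hy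
      obtain ⟨j, rfl⟩ := hz
      exact hp i j
    | zero_left y hy => simp
    | zero_right y hy => simp
    | add_left y y' z _ _ _ h h' =>
      rw [← add_zero (0 : R)]
      nth_rewrite 1 [← h]
      rw [← h', ← sum_add_distrib]
      exact sum_congr rfl fun n _ => by simp only [Pi.add_apply]; ring
    | add_right y z z' _ _ _ h h' =>
      rw [← add_zero (0 : R)]
      nth_rewrite 1 [← h]
      rw [← h', ← sum_add_distrib]
      exact sum_congr rfl fun n _ => by simp only [Pi.add_apply]; ring
    | smul_left r y z _ _ h =>
      rw [← mul_zero r, ← h, mul_sum]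
      exact sum_congr rfl fun n _ => by simp only [Pi.smul_apply, smul_eq_mul]; ring
    | smul_right r y z _ _ h =>
      rw [← mul_zero r, ← h, mul_sum]
      exact sum_congr rfl fun n _ => by simp only [Pi.smul_apply, smul_eq_mul]; ring
  induction hx using Submodule.span_induction with
  | mem y hy =>
    obtain ⟨i, rfl⟩ := hy
    exact hq i
  | zero => simp
  | add y z hy hz h h' =>
    calc ∑ n, (y + z) n * (y + z) (σ n)
        = ∑ n, y n * y (σ n) + ∑ n, z n * z (σ n)
          + ∑ n, (y n * z (σ n) + z n * y (σ n)) := by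
          rw [← sum_add_distrib, ← sum_add_distrib]
          exact sum_congr rfl fun n _ => by simp only [Pi.add_apply]; ring
      _ = 0 := by rw [h, h', polar y hy z hz, add_zero, add_zero]
  | smul r y _ h =>
    rw [← mul_zero (r * r), ← h, mul_sum]
    exact sum_congr rfl fun n _ => by simp only [Pi.smul_apply, smul_eq_mul]; ring

/-- Every vector `x` in the `ZMod 2`-span of the images of `g^0, …, g^14` in `(ZMod 2)^24`
satisfies `∑_{n=0}^{23} x_n · x_{π(n)} = 0` in `ZMod 2`; consequently every flat
configuration contributes with sign `+1` to the `N = 2` Kashaev torus partition sum. -/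
theorem span_quadratic_form_zero (x : Fin 24 → ZMod 2)
    (hx : x ∈ Submodule.span (ZMod 2)
      (Set.range (fun i : Fin 15 => fun n : Fin 24 => ((gVec i n : ℤ) : ZMod 2)))) :
    ∑ n : Fin 24, x n * x (piPerm n) = 0 := by
  exact sum_mul_comp_eq_zero_of_mem_span piPerm _ (by decide +kernel) (by decide +kernel) hx
end

section
/- Writing S for the ZMod 2-linear span of the images of g^0, …, g^14 in (ZMod 2)^{24}, one has (1/2^{12})·∑_{x ∈ S} (−1)^{q(x)} = 8, where q(x) ∈ {0,1} denotes any integer lift of ∑_{n=0}^{23} x_n · x_{π(n)} ∈ ZMod 2. (This is the value dim V[T^3] = Z[T^4] = 8 of the N = 2 Kashaev TQFT.) -/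
open Finset

/-- A bilinear form that is alternating on a set is alternating on its span. -/
theorem LinearMap.BilinForm.apply_self_eq_zero_of_mem_span {R M : Type*} [CommRing R]
    [AddCommGroup M] [Module R M] (B : LinearMap.BilinForm R M) {s : Set M}
    (hself : ∀ v ∈ s, B v v = 0) (hswap : ∀ v ∈ s, ∀ w ∈ s, B v w + B w v = 0)
    {x : M} (hx : x ∈ Submodule.span R s) : B x x = 0 := by
  have hspan : ∀ y ∈ Submodule.span R s, ∀ z ∈ Submodule.span R s, B y z + B z y = 0 := by
    intro y hy z hz
    induction hy, hz using Submodule.span_induction₂ with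
    | mem_mem v w hv hw => exact hswap v hv w hw
    | zero_left | zero_right => simp
    | add_left a b c _ _ _ ha hb =>
      simp only [map_add, LinearMap.add_apply]
      linear_combination ha + hb
    | add_right a b c _ _ _ ha hb =>
      simp only [map_add, LinearMap.add_apply]
      linear_combination ha + hb
    | smul_left r a b _ _ h | smul_right r a b _ _ h =>
      simp only [map_smul, LinearMap.smul_apply, smul_eq_mul]
      linear_combination r * h
  induction hx using Submodule.span_induction with
  | mem v hv => exact hself v hv
  | zero => simp
  | add y z hy hz ihy ihz =>
    simp only [map_add, LinearMap.add_apply]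
    linear_combination ihy + ihz + hspan y hy z hz
  | smul r y _ ih => simp [ih]

/-- The bilinear form `(x, y) ↦ ∑ n, x n * y (σ n)`. -/
def permBilin (R : Type*) [CommRing R] {ι : Type*} [Fintype ι] (σ : ι → ι) :
    LinearMap.BilinForm R (ι → R) :=
  LinearMap.mk₂ R (fun x y => ∑ n, x n * y (σ n))
    (by simp [add_mul, Finset.sum_add_distrib]) (by simp [Finset.mul_sum, mul_assoc])
    (by simp [mul_add, Finset.sum_add_distrib]) (by simp [Finset.mul_sum, mul_left_comm])

theorem permBilin_apply {R : Type*} [CommRing R] {ι : Type*} [Fintype ι] (σ : ι → ι)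
    (x y : ι → R) : permBilin R σ x y = ∑ n, x n * y (σ n) := rfl

theorem permBilin_gVec_self (i : Fin 15) :
    ∑ n, ((gVec i n : ℤ) : ZMod 2) * ((gVec i (piPerm n) : ℤ) : ZMod 2) = 0 := by
  revert i
  decide +kernel

theorem permBilin_gVec_swap (i j : Fin 15) :
    ∑ n, ((gVec i n : ℤ) : ZMod 2) * ((gVec j (piPerm n) : ℤ) : ZMod 2) +
      ∑ n, ((gVec j n : ℤ) : ZMod 2) * ((gVec i (piPerm n) : ℤ) : ZMod 2) = 0 := by
  revert i j
  decide +kernel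

theorem linearIndependent_gVec :
    LinearIndependent (ZMod 2)
      (fun i : Fin 15 => fun n : Fin 24 => ((gVec i n : ℤ) : ZMod 2)) := by
  rw [Fintype.linearIndependent_iff]
  intro c hc
  have coord (n : Fin 24) : ∑ i, c i * ((gVec i n : ℤ) : ZMod 2) = 0 := by
    simpa using congrFun hc n
  simp only [Fin.forall_fin_succ, Fin.sum_univ_succ, gVec, gSet] at coord
  simp at coord
  simp [Fin.forall_fin_succ]
  grind

/-- With `S` the `ZMod 2`-span of the images of `g^0, …, g^14` in `(ZMod 2)^24`,
`(1/2^12)·∑_{x ∈ S} (−1)^{q(x)} = 8`, where `q(x)` is the integer lift (`.val`) of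
`∑_{n} x_n·x_{π(n)} ∈ ZMod 2`.  This is the value `dim V[T³] = Z[T⁴] = 8` of the
`N = 2` Kashaev TQFT. -/
theorem kashaev_two_T4_sum_over_span :
    (1 / 2 ^ 12 : ℝ) *
      ∑ᶠ x ∈ (Submodule.span (ZMod 2)
          (Set.range (fun i : Fin 15 => fun n : Fin 24 => ((gVec i n : ℤ) : ZMod 2))) :
            Set (Fin 24 → ZMod 2)),
        (-1 : ℝ) ^ (∑ n : Fin 24, x n * x (piPerm n)).val = 8 := by
  set S := Submodule.span (ZMod 2)
    (Set.range (fun i : Fin 15 => fun n : Fin 24 => ((gVec i n : ℤ) : ZMod 2)))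
  have hq : ∀ x ∈ (S : Set (Fin 24 → ZMod 2)),
      (-1 : ℝ) ^ (∑ n : Fin 24, x n * x (piPerm n)).val = 1 := by
    intro x hx
    have hzero : permBilin (ZMod 2) piPerm x x = 0 := by
      refine LinearMap.BilinForm.apply_self_eq_zero_of_mem_span _ ?_ ?_ hx
      · rintro _ ⟨i, rfl⟩
        exact permBilin_gVec_self i
      · rintro _ ⟨i, rfl⟩ _ ⟨j, rfl⟩
        exact permBilin_gVec_swap i j
    rw [← permBilin_apply, hzero, ZMod.val_zero, pow_zero]
  have hcard : (S : Set (Fin 24 → ZMod 2)).ncard = 2 ^ 15 := by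
    rw [← Nat.card_coe_set_eq, SetLike.coe_sort_coe, Module.natCard_eq_pow_finrank (K := ZMod 2),
      finrank_span_eq_card linearIndependent_gVec]
    simp
  rw [finsum_mem_congr rfl hq, finsum_mem_eq_finite_toFinset_sum _ (Set.toFinite _),
    Finset.sum_const, ← Set.ncard_eq_toFinset_card, hcard]
  norm_num
end

section
/- For all integers x_0, …, x_14, setting x = ∑_{i=0}^{14} x_i · g^i ∈ ℤ^{24}, one has the integer identity ∑_{n=0}^{23} (−1)^n · x_n · x_{π(n)} = 2·( x_0·(x_8 − x_5) + (x_1 − x_9)·(x_4 − x_7) + (x_2 − x_{10})·(x_6 − x_3) ). -/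
open Finset

/-- The coordinates of `∑ i, c i • g^i`: every index lies in exactly one of the last four sets
and, except for `10` and `21`, in exactly one of the first eleven. -/
theorem sum_mul_gVec (c : Fin 15 → ℤ) (n : Fin 24) :
    ∑ i : Fin 15, c i * gVec i n =
      ![c 1 + c 11, c 5 + c 12, c 10 + c 13, c 9 + c 11, c 8 + c 12, c 2 + c 13, c 4 + c 12,
        c 0 + c 11, c 2 + c 14, c 7 + c 12, c 11, c 10 + c 14, c 3 + c 11, c 4 + c 13, c 5 + c 14,
        c 6 + c 11, c 7 + c 13, c 8 + c 14, c 0 + c 13, c 3 + c 12, c 9 + c 14, c 13, c 6 + c 12,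
        c 1 + c 14] n := by
  fin_cases n <;> simp [Fin.sum_univ_succ, gVec, gSet]

/-- For all integers `x_0, …, x_14`, with `x = ∑_i x_i·g^i ∈ ℤ^24`, one has
`∑_{n=0}^{23} (−1)^n x_n x_{π(n)}
  = 2·(x_0(x_8−x_5) + (x_1−x_9)(x_4−x_7) + (x_2−x_{10})(x_6−x_3))`. -/
theorem quadratic_form_on_span (c : Fin 15 → ℤ) :
    (∑ n : Fin 24, (-1 : ℤ) ^ (n : ℕ) *
        (∑ i : Fin 15, c i * gVec i n) * (∑ i : Fin 15, c i * gVec i (piPerm n))) =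
      2 * (c 0 * (c 8 - c 5) + (c 1 - c 9) * (c 4 - c 7) + (c 2 - c 10) * (c 6 - c 3)) := by
  simp only [sum_mul_gVec]
  simp [Fin.sum_univ_succ, piPerm]
  ring
end
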